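/- Suppose a holomorphic function f on ℂ × H satisfies f(t + 2, τ) = f(t, τ) and f(t + 2τ, τ) = f(t, τ) for all (t, τ), and suppose that for each fixed τ, f(·, τ) extends to a meromorphic function on ℂ whose only possible poles lie on lines t = r(cτ + d) for rational r and coprime integers c, d. If additionally f(·, τ) is holomorphic on ℝ for every τ ∈ H, and f is invariant (up to nonzero factor) under the SL₂(ℤ)-action g·(t,τ) = (t/(cτ+d), (aτ+b)/(cτ+d)) in the sense that for every g ∈ SL₂(ℤ) the function (t,τ) ↦ f(g·(t,τ)) is again holomorphic on ℝ × H, then f(·, τ) is holomorphic on all of ℂ for each τ, hence constant in t on the torus ℂ/(2ℤ + 2ℤτ). -/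

import Mathlib

open Complex

/-- The action of `SL₂(ℤ)` on `ℂ × H`. -/
noncomputable def modAct (g : Matrix.SpecialLinearGroup (Fin 2) ℤ) (p : ℂ × ℂ) : ℂ × ℂ :=
  (p.1 / ((g.1 1 0 : ℤ) * p.2 + ((g.1 1 1 : ℤ) : ℂ)),
   (((g.1 0 0 : ℤ) : ℂ) * p.2 + ((g.1 0 1 : ℤ) : ℂ)) / (((g.1 1 0 : ℤ) : ℂ) * p.2 + ((g.1 1 1 : ℤ) : ℂ)))

/-- `cτ + d` is nonzero for coprime integers `c, d` and `τ` in the upper half-plane. -/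
lemma coprime_denom_ne_zero {τ : ℂ} (hτ : 0 < τ.im) {c d : ℤ} (hcd : IsCoprime c d) :
    (c : ℂ) * τ + d ≠ 0 := by
  intro h
  have him := congrArg Complex.im h
  simp only [add_im, mul_im, intCast_re, intCast_im, zero_mul, add_zero, zero_im,
    mul_eq_zero, hτ.ne', or_false] at him
  have hc : c = 0 := by exact_mod_cast him
  subst hc
  have hd : d = 0 := by simpa using h
  subst hd
  exact not_isCoprime_zero_zero hcd

/-- For coprime `c, d`, every `τ` in the upper half-plane is the image of some `τ'` under a
modular transformation that acts on the first coordinate as multiplication by `cτ + d`. -/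
lemma exists_modAct_eq_mul_denom {τ : ℂ} (hτ : 0 < τ.im) {c d : ℤ} (hcd : IsCoprime c d) :
    ∃ g : Matrix.SpecialLinearGroup (Fin 2) ℤ, ∃ τ' : ℂ, 0 < τ'.im ∧
      ∀ s : ℂ, modAct g (s, τ') = (s * ((c : ℂ) * τ + d), τ) := by
  have hne := coprime_denom_ne_zero hτ hcd
  obtain ⟨u, v, huv⟩ := hcd
  have huv' : (u : ℂ) * c + v * d = 1 := by exact_mod_cast huv
  have huvR : (u : ℝ) * c + v * d = 1 := by exact_mod_cast huv
  have hden : -(c : ℂ) * ((v * τ - u) / (c * τ + d)) + v = 1 / (c * τ + d) := by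
    rw [eq_div_iff hne, add_mul, mul_assoc, div_mul_cancel₀ _ hne]
    linear_combination huv'
  have hnum : (d : ℂ) * ((v * τ - u) / (c * τ + d)) + u = τ / (c * τ + d) := by
    rw [eq_div_iff hne, add_mul, mul_assoc, div_mul_cancel₀ _ hne]
    linear_combination τ * huv'
  refine ⟨⟨!![d, u; -c, v], by rw [Matrix.det_fin_two_of]; linear_combination huv⟩,
    (v * τ - u) / (c * τ + d), ?_, fun s => ?_⟩
  · have him : (((v : ℂ) * τ - u) / (c * τ + d)).im = τ.im / normSq (c * τ + d) := by
      rw [div_im, ← sub_div]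
      congr 1
      simp only [sub_im, mul_im, intCast_re, intCast_im, zero_mul, add_zero, sub_zero, add_re,
        mul_re, sub_re, add_im]
      linear_combination τ.im * huvR
    rw [him]
    exact div_pos hτ (normSq_pos.mpr hne)
  · simp only [modAct, Matrix.of_apply, Matrix.cons_val', Matrix.cons_val_zero,
      Matrix.cons_val_one, Matrix.cons_val_fin_one, Int.cast_neg, hden, hnum]
    exact Prod.ext (by rw [div_div_eq_mul_div, div_one])
      (by rw [div_div_div_cancel_right₀ hne, div_one])

/-- An entire function with periods `2` and `2τ`, where `τ` is in the upper half-plane, is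
constant. -/
lemma Differentiable.apply_eq_apply_of_periodic {F : ℂ → ℂ} (hF : Differentiable ℂ F) {τ : ℂ}
    (hτ : 0 < τ.im) (h₁ : Function.Periodic F 2) (h₂ : Function.Periodic F (2 * τ)) (z w : ℂ) :
    F z = F w := by
  refine hF.apply_eq_apply_of_bounded ?_ z w
  have hK : IsCompact ((fun p : ℝ × ℝ => F (p.1 * 2 + p.2 * (2 * τ))) ''
      (Set.Icc 0 1 ×ˢ Set.Icc 0 1)) :=
    (isCompact_Icc.prod isCompact_Icc).image
      (hF.continuous.comp (by fun_prop))
  refine hK.isBounded.subset ?_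
  rintro _ ⟨t, rfl⟩
  obtain ⟨x, y, rfl⟩ : ∃ x y : ℝ, t = x * 2 + y * (2 * τ) := by
    refine ⟨(t.re - t.im / τ.im * τ.re) / 2, t.im / τ.im / 2, ?_⟩
    apply Complex.ext
    · simp
      ring
    · simp
      field_simp
  refine ⟨(Int.fract x, Int.fract y), ⟨⟨Int.fract_nonneg x, (Int.fract_lt_one x).le⟩,
    ⟨Int.fract_nonneg y, (Int.fract_lt_one y).le⟩⟩, ?_⟩
  have hshift : (x : ℂ) * 2 + y * (2 * τ) =
      (Int.fract x : ℝ) * 2 + (Int.fract y : ℝ) * (2 * τ) + ⌊x⌋ * 2 + ⌊y⌋ * (2 * τ) := by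
    simp only [Int.fract, ofReal_sub, ofReal_intCast]
    ring
  rw [hshift, h₂.int_mul ⌊y⌋, h₁.int_mul ⌊x⌋]

/-- If `f(t,τ)` is doubly periodic in `t` with periods `2` and `2τ`, is meromorphic in `t` with
possible poles only on the lines `t = r(cτ+d)` (`r` rational, `c,d` coprime), is holomorphic at
real `t`, and every modular transform `f ∘ g` is holomorphic at real `t`, then for each `τ` the
function `f(·,τ)` is holomorphic on all of `ℂ`, hence constant in `t`. -/
theorem rigidity_holomorphic_constant (f : ℂ → ℂ → ℂ)
    (hper1 : ∀ t τ : ℂ, 0 < τ.im → f (t + 2) τ = f t τ)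
    (hper2 : ∀ t τ : ℂ, 0 < τ.im → f (t + 2 * τ) τ = f t τ)
    (hmero : ∀ τ : ℂ, 0 < τ.im → MeromorphicOn (fun t => f t τ) Set.univ)
    (hpoles : ∀ τ t : ℂ, 0 < τ.im → ¬ AnalyticAt ℂ (fun s => f s τ) t →
      ∃ r : ℚ, ∃ c d : ℤ, IsCoprime c d ∧ t = (r : ℂ) * ((c : ℂ) * τ + (d : ℂ)))
    (hreal : ∀ τ : ℂ, 0 < τ.im → ∀ x : ℝ, AnalyticAt ℂ (fun s => f s τ) (x : ℂ))
    (hmod : ∀ g : Matrix.SpecialLinearGroup (Fin 2) ℤ, ∀ τ : ℂ, 0 < τ.im → ∀ x : ℝ,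
      AnalyticAt ℂ (fun s => f (modAct g (s, τ)).1 (modAct g (s, τ)).2) (x : ℂ)) :
    ∀ τ : ℂ, 0 < τ.im →
      (∀ t : ℂ, AnalyticAt ℂ (fun s => f s τ) t) ∧ ∀ t t' : ℂ, f t τ = f t' τ := by
  intro τ hτ
  have hanalytic : ∀ t : ℂ, AnalyticAt ℂ (fun s => f s τ) t := by
    intro t
    by_contra hpole
    obtain ⟨r, c, d, hcd, rfl⟩ := hpoles τ t hτ hpole
    have hne := coprime_denom_ne_zero hτ hcd
    obtain ⟨g, τ', hτ', hg⟩ := exists_modAct_eq_mul_denom hτ hcd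
    have hr := hmod g τ' hτ' r
    simp only [hg] at hr
    have hdiv : AnalyticAt ℂ (fun s : ℂ => s / ((c : ℂ) * τ + d)) (r * ((c : ℂ) * τ + d)) :=
      analyticAt_id.div analyticAt_const hne
    refine hpole ((hr.comp_of_eq hdiv ?_).congr (.of_forall fun s => ?_))
    · simp [mul_div_cancel_right₀ _ hne]
    · simp [div_mul_cancel₀ _ hne]
  exact ⟨hanalytic, Differentiable.apply_eq_apply_of_periodic
    (fun t => (hanalytic t).differentiableAt) hτ (fun t => hper1 t τ hτ) fun t => hper2 t τ hτ⟩
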